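/- arXiv:1406.6593 — 7 statements merged into one kernel-verified Lean document; each statement's English description precedes it below -/
import Mathlib

section
/- There exists a smallest subset P ⊆ I (with respect to inclusion) for which there exists λ̌_P ∈ Λ̌_P with φ_P(λ̌_P) = φ_I(λ̌_G) and π_P(λ̌_P) = λ̌_G; namely P = I(λ̌_G) has this property and is contained in every subset J ⊆ I for which some λ̌_J ∈ Λ̌_J satisfies φ_J(λ̌_J) = φ_I(λ̌_G) and π_J(λ̌_J) = λ̌_G. Moreover, for P = I(λ̌_G) the element λ̌_P satisfying these two equations is unique. -/
theorem coeff_eq_zero_of_sum_mem_span_image {K V I : Type*} [Field K] [AddCommGroup V] [Module K V]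
    [Fintype I] {v : I → V} (hv : LinearIndependent K v) {J : Finset I} {x : I → K}
    (hx : ∑ i, x i • v i ∈ Submodule.span K (v '' (J : Set I))) {i : I} (hi : i ∉ J) :
    x i = 0 := by
  classical
  obtain ⟨d, hd⟩ := (Submodule.mem_span_image_finset_iff_exists_fun' K).1 hx
  have hsum : ∑ k, (x k - if k ∈ J then d k else 0) • v k = 0 := by
    simp [sub_smul, Finset.sum_sub_distrib, ite_smul, ← hd]
  simpa [hi] using Fintype.linearIndependent_iff.1 hv _ hsum i

theorem eq_zero_of_mem_span_image_of_det_ne_zero {K V I : Type*} [Field K] [AddCommGroup V]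
    [Module K V] [DecidableEq I] {v : I → V} {f : I → V →ₗ[K] K} {J : Finset I}
    (hdet : (Matrix.of fun i j : {x // x ∈ J} => f j.1 (v i.1)).det ≠ 0) {w : V}
    (hw : w ∈ Submodule.span K (v '' (J : Set I))) (hf : ∀ j ∈ J, f j w = 0) : w = 0 := by
  obtain ⟨d, rfl⟩ := (Submodule.mem_span_image_finset_iff_exists_fun K).1 hw
  have hd : d = 0 := by
    refine Matrix.eq_zero_of_vecMul_eq_zero hdet (funext fun j => ?_)
    simpa [Matrix.vecMul, dotProduct] using hf j.1 j.2
  simp [hd]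

/-- the key lemma: `P = I(λ̌_G)` is the smallest subset of `I` admitting
a degree `λ̌_P` with `φ_P(λ̌_P) = φ_I(λ̌_G)` and `π_P(λ̌_P) = λ̌_G`, and `λ̌_P` is unique. -/
theorem smallest_parabolic_exists_unique
    -- `Λ̌`, a finitely generated free `ℤ`-module
    (Λ : Type*) [AddCommGroup Λ] [Module ℤ Λ] [Module.Free ℤ Λ] [Module.Finite ℤ Λ]
    -- `Λ̌_ℚ = Λ̌ ⊗ ℚ`, realized as a `ℚ`-vector space containing `Λ̌` via `ι` and spanned by it
    (V : Type*) [AddCommGroup V] [Module ℚ V]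
    (ι : Λ →ₗ[ℤ] V) (hι : Function.Injective ι)
    (hspan : Submodule.span ℚ (Set.range ι) = ⊤)
    -- the finite index set, the simple coroots and the simple roots
    (I : Type*) [Fintype I] [DecidableEq I]
    (a : I → Λ)
    (ha : LinearIndependent ℚ (fun i => ι (a i)))
    (α : I → (Λ →ₗ[ℤ] ℤ))
    -- the `ℚ`-linear extensions of the simple roots to `Λ̌_ℚ`
    (αQ : I → (V →ₗ[ℚ] ℚ))
    (hαQ : ∀ i x, αQ i (ι x) = (α i x : ℚ))
    -- all submatrices `(α_j(ǎ_i))_{i,j ∈ J}` of the Cartan matrix are invertible over `ℚ`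
    (hinv : ∀ J : Finset I,
      (Matrix.of fun i j : {x // x ∈ J} => ((α j.1 (a i.1) : ℤ) : ℚ)).det ≠ 0)
    -- the slope maps `φ_J : Λ̌_J → Λ̌_ℚ`, with their defining property
    (φ : ∀ J : Finset I, (Λ ⧸ Submodule.span ℤ (a '' (J : Set I))) → V)
    (hφ : ∀ (J : Finset I) (lam : Λ),
      (∀ j ∈ J, αQ j (φ J (Submodule.Quotient.mk lam)) = 0) ∧
      φ J (Submodule.Quotient.mk lam) - ι lam ∈
        Submodule.span ℚ ((fun i => ι (a i)) '' (J : Set I)))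
    -- the natural projections `π_J : Λ̌_J → Λ̌_I`
    (π : ∀ J : Finset I, (Λ ⧸ Submodule.span ℤ (a '' (J : Set I))) →
      (Λ ⧸ Submodule.span ℤ (a '' ((Finset.univ : Finset I) : Set I))))
    (hπ : ∀ (J : Finset I) (lam : Λ),
      π J (Submodule.Quotient.mk lam) = Submodule.Quotient.mk lam)
    -- a fixed degree `λ̌_G ∈ Λ̌_I`, a lift `lam0` of it, and the coefficients
    -- `c i` of `φ_I(λ̌_G) - λ̌` in the basis of simple coroots
    (lamG : Λ ⧸ Submodule.span ℤ (a '' ((Finset.univ : Finset I) : Set I)))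
    (lam0 : Λ) (hlam0 : Submodule.Quotient.mk lam0 = lamG)
    (c : I → ℚ)
    (hc : φ Finset.univ lamG - ι lam0 = ∑ i, c i • ι (a i))
    -- `P := I(λ̌_G) = {i ∈ I : c_i ∉ ℤ}`
    (P : Finset I) (hP : ∀ i, i ∈ P ↔ ¬∃ n : ℤ, (n : ℚ) = c i) :
    -- `P` admits a suitable degree `λ̌_P`,
    (∃ lamP : Λ ⧸ Submodule.span ℤ (a '' (P : Set I)),
        φ P lamP = φ Finset.univ lamG ∧ π P lamP = lamG) ∧
    -- `P` is contained in any subset `J` admitting a suitable degree,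
    (∀ J : Finset I,
        (∃ lamJ : Λ ⧸ Submodule.span ℤ (a '' (J : Set I)),
          φ J lamJ = φ Finset.univ lamG ∧ π J lamJ = lamG) → P ⊆ J) ∧
    -- and the degree `λ̌_P` is unique
    (∀ lamP lamP' : Λ ⧸ Submodule.span ℤ (a '' (P : Set I)),
        φ P lamP = φ Finset.univ lamG → π P lamP = lamG →
        φ P lamP' = φ Finset.univ lamG → π P lamP' = lamG → lamP = lamP') := by
  have hmap : ∀ n : I → ℤ, ι (∑ i, n i • a i) = ∑ i, (n i : ℚ) • ι (a i) := fun n => by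
    simp [map_sum, Int.cast_smul_eq_zsmul]
  have hslope : ∀ j, αQ j (φ Finset.univ lamG) = 0 := fun j => by
    rw [← hlam0]
    exact (hφ Finset.univ lam0).1 j (Finset.mem_univ j)
  have hdiff : ∀ lam lam' : Λ,
      (Submodule.Quotient.mk lam :
        Λ ⧸ Submodule.span ℤ (a '' ((Finset.univ : Finset I) : Set I))) =
        Submodule.Quotient.mk lam' →
      ∃ n : I → ℤ, ∑ i, n i • a i = lam - lam' := fun lam lam' h => by
    obtain ⟨n, hn⟩ :=
      (Submodule.mem_span_image_finset_iff_exists_fun' ℤ).1 ((Submodule.Quotient.eq _).1 h)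
    exact ⟨n, hn ▸ Finset.sum_congr rfl fun i _ => (int_smul_eq_zsmul _ _ _).symm⟩
  refine ⟨?_, ?_, ?_⟩
  · have hcoeff : ∀ i, ∃ n : ℤ, i ∉ P → (n : ℚ) = c i := fun i => by
      by_cases hi : i ∈ P
      · exact ⟨0, fun h => absurd hi h⟩
      · obtain ⟨n, hn⟩ := not_not.1 (mt (hP i).2 hi)
        exact ⟨n, fun _ => hn⟩
    choose n hn using hcoeff
    set lam := lam0 + ∑ i, n i • a i with hlam
    have hmem : φ Finset.univ lamG - ι lam ∈
        Submodule.span ℚ ((fun i => ι (a i)) '' (P : Set I)) := by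
      have h : φ Finset.univ lamG - ι lam = ∑ i, (c i - n i) • ι (a i) := by
        rw [hlam, map_add, hmap, ← sub_sub, hc]
        simp only [sub_smul, Finset.sum_sub_distrib]
      rw [h]
      refine Submodule.sum_mem _ fun i _ => ?_
      by_cases hi : i ∈ P
      · exact Submodule.smul_mem _ _ (Submodule.subset_span ⟨i, hi, rfl⟩)
      · simp [hn i hi]
    refine ⟨Submodule.Quotient.mk lam, ?_, ?_⟩
    · rw [← sub_eq_zero]
      refine eq_zero_of_mem_span_image_of_det_ne_zero (v := fun i => ι (a i)) (f := αQ) (J := P)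
        ?_ ?_ ?_
      · simpa only [hαQ] using hinv P
      · simpa using Submodule.sub_mem _ (hφ P lam).2 hmem
      · intro j hj
        rw [map_sub, (hφ P lam).1 j hj, hslope, sub_zero]
    · rw [hπ, ← hlam0, Submodule.Quotient.eq, hlam, add_sub_cancel_left]
      exact Submodule.sum_mem _ fun i _ =>
        zsmul_mem (Submodule.subset_span
          (Set.mem_image_of_mem a (Finset.mem_coe.2 (Finset.mem_univ i)))) _
  · rintro J ⟨lamJ, hφJ, hπJ⟩ i hiP
    obtain ⟨lam, rfl⟩ := Submodule.Quotient.mk_surjective _ lamJ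
    by_contra hiJ
    rw [hπ, ← hlam0] at hπJ
    obtain ⟨n, hn⟩ := hdiff _ _ hπJ
    have hmem := (hφ J lam).2
    have h : φ Finset.univ lamG - ι lam = ∑ i, (c i - n i) • ι (a i) := by
      rw [← sub_add_cancel lam lam0, ← hn, map_add, hmap, add_comm, ← sub_sub, hc]
      simp only [sub_smul, Finset.sum_sub_distrib]
    rw [hφJ, h] at hmem
    have hzero := coeff_eq_zero_of_sum_mem_span_image ha hmem hiJ
    exact (hP i).1 hiP ⟨n i, (sub_eq_zero.1 hzero).symm⟩
  · intro lamP lamP' hφ₁ hπ₁ hφ₂ hπ₂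
    obtain ⟨lam, rfl⟩ := Submodule.Quotient.mk_surjective _ lamP
    obtain ⟨lam', rfl⟩ := Submodule.Quotient.mk_surjective _ lamP'
    rw [hπ] at hπ₁ hπ₂
    obtain ⟨n, hn⟩ := hdiff _ _ (hπ₁.trans hπ₂.symm)
    have hmem := Submodule.sub_mem _ (hφ P lam').2 (hφ P lam).2
    rw [hφ₁, hφ₂, sub_sub_sub_cancel_left, ← map_sub, ← hn, hmap] at hmem
    rw [Submodule.Quotient.eq, ← hn]
    refine Submodule.sum_mem _ fun i _ => ?_
    by_cases hi : i ∈ P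
    · exact zsmul_mem (Submodule.subset_span (Set.mem_image_of_mem a hi)) _
    · have hzero : n i = 0 := by
        exact_mod_cast coeff_eq_zero_of_sum_mem_span_image ha hmem hi
      rw [hzero, zero_smul]
      exact Submodule.zero_mem _
end

section
/- If J ⊆ I is a subset for which there exists λ̌_J ∈ Λ̌_J with φ_J(λ̌_J) = φ_I(λ̌_G) and π_J(λ̌_J) = λ̌_G, then I(λ̌_G) ⊆ J. -/
/-- An element of the span of the vectors indexed by `J` is a combination of the whole family
whose coefficients vanish off `J`. -/
theorem Submodule.exists_sum_smul_of_mem_span_image {R M ι : Type*} [Semiring R]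
    [AddCommMonoid M] [Module R M] [Fintype ι] [DecidableEq ι] {v : ι → M} {J : Finset ι} {x : M}
    (hx : x ∈ Submodule.span R (v '' (J : Set ι))) :
    ∃ d : ι → R, (∀ i ∉ J, d i = 0) ∧ ∑ i, d i • v i = x := by
  obtain ⟨d, rfl⟩ := (Submodule.mem_span_image_finset_iff_exists_fun R).1 hx
  refine ⟨fun i => if h : i ∈ J then d ⟨i, h⟩ else 0, fun i hi => dif_neg hi, ?_⟩
  rw [← Finset.sum_subset J.subset_univ fun i _ hi => by simp [hi],
    ← Finset.sum_coe_sort J]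
  exact Finset.sum_congr rfl fun i _ => by simp

/-- if `J ⊆ I` admits `λ̌_J` with `φ_J(λ̌_J) = φ_I(λ̌_G)` and
`π_J(λ̌_J) = λ̌_G`, then `I(λ̌_G) ⊆ J`. -/
theorem parabolic_set_subset_of_admissible
    -- `Λ̌`, a finitely generated free `ℤ`-module
    (Λ : Type*) [AddCommGroup Λ] [Module ℤ Λ] [Module.Free ℤ Λ] [Module.Finite ℤ Λ]
    -- `Λ̌_ℚ = Λ̌ ⊗ ℚ`, realized as a `ℚ`-vector space containing `Λ̌` via `ι` and spanned by it
    (V : Type*) [AddCommGroup V] [Module ℚ V]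
    (ι : Λ →ₗ[ℤ] V) (hι : Function.Injective ι)
    (hspan : Submodule.span ℚ (Set.range ι) = ⊤)
    -- the finite index set, the simple coroots and the simple roots
    (I : Type*) [Fintype I] [DecidableEq I]
    (a : I → Λ)
    (ha : LinearIndependent ℚ (fun i => ι (a i)))
    (α : I → (Λ →ₗ[ℤ] ℤ))
    -- the `ℚ`-linear extensions of the simple roots to `Λ̌_ℚ`
    (αQ : I → (V →ₗ[ℚ] ℚ))
    (hαQ : ∀ i x, αQ i (ι x) = (α i x : ℚ))
    -- all submatrices `(α_j(ǎ_i))_{i,j ∈ J}` of the Cartan matrix are invertible over `ℚ`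
    (hinv : ∀ J : Finset I,
      (Matrix.of fun i j : {x // x ∈ J} => ((α j.1 (a i.1) : ℤ) : ℚ)).det ≠ 0)
    -- the slope maps `φ_J : Λ̌_J → Λ̌_ℚ`, with their defining property
    (φ : ∀ J : Finset I, (Λ ⧸ Submodule.span ℤ (a '' (J : Set I))) → V)
    (hφ : ∀ (J : Finset I) (lam : Λ),
      (∀ j ∈ J, αQ j (φ J (Submodule.Quotient.mk lam)) = 0) ∧
      φ J (Submodule.Quotient.mk lam) - ι lam ∈
        Submodule.span ℚ ((fun i => ι (a i)) '' (J : Set I)))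
    -- the natural projections `π_J : Λ̌_J → Λ̌_I`
    (π : ∀ J : Finset I, (Λ ⧸ Submodule.span ℤ (a '' (J : Set I))) →
      (Λ ⧸ Submodule.span ℤ (a '' ((Finset.univ : Finset I) : Set I))))
    (hπ : ∀ (J : Finset I) (lam : Λ),
      π J (Submodule.Quotient.mk lam) = Submodule.Quotient.mk lam)
    -- a fixed degree `λ̌_G ∈ Λ̌_I`, a lift `lam0` of it, and the coefficients
    -- `c i` of `φ_I(λ̌_G) - λ̌` in the basis of simple coroots
    (lamG : Λ ⧸ Submodule.span ℤ (a '' ((Finset.univ : Finset I) : Set I)))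
    (lam0 : Λ) (hlam0 : Submodule.Quotient.mk lam0 = lamG)
    (c : I → ℚ)
    (hc : φ Finset.univ lamG - ι lam0 = ∑ i, c i • ι (a i))
    :
    ∀ J : Finset I,
      (∃ lamJ : Λ ⧸ Submodule.span ℤ (a '' (J : Set I)),
        φ J lamJ = φ Finset.univ lamG ∧ π J lamJ = lamG) →
      ∀ i : I, (¬∃ n : ℤ, (n : ℚ) = c i) → i ∈ J := by
  intro J ⟨lamJ, hslope, hdeg⟩ i hi
  by_contra hiJ
  obtain ⟨l, rfl⟩ := Submodule.Quotient.mk_surjective _ lamJ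
  rw [hπ, ← hlam0, Submodule.Quotient.eq] at hdeg
  obtain ⟨n, -, hn⟩ := Submodule.exists_sum_smul_of_mem_span_image hdeg
  obtain ⟨d, hd, hsum⟩ := Submodule.exists_sum_smul_of_mem_span_image (hφ J l).2
  have hn' : ∑ j, (n j : ℚ) • ι (a j) = ι l - ι lam0 := by
    rw [← map_sub, ← hn, map_sum]
    exact Finset.sum_congr rfl fun j _ =>
      (Int.cast_smul_eq_zsmul ℚ _ _).trans (ι.map_smul _ _).symm
  have hzero : ∑ j, (c j - n j - d j) • ι (a j) = 0 := by
    simp only [sub_smul, Finset.sum_sub_distrib]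
    rw [← hc, hn', hsum, hslope]
    abel
  have hci := Fintype.linearIndependent_iff.1 ha _ hzero i
  rw [hd i hiJ] at hci
  exact hi ⟨n i, by linarith⟩
end

section
/- For the subset P := I(λ̌_G) there exists an element λ̌_P ∈ Λ̌_P with φ_P(λ̌_P) = φ_I(λ̌_G) and π_P(λ̌_P) = λ̌_G. -/
/-- A vector in the span of the `b i`, `i ∈ J`, that is killed by the functionals `f j`, `j ∈ J`,
vanishes as soon as the matrix `(f j (b i))` has nonzero determinant. -/
theorem eq_zero_of_mem_span_of_det_ne_zero {K V I : Type*} [Field K] [AddCommGroup V] [Module K V]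
    [DecidableEq I] (J : Finset I) (b : I → V) (f : I → V →ₗ[K] K)
    (hdet : (Matrix.of fun i j : {x // x ∈ J} => f j.1 (b i.1)).det ≠ 0)
    {w : V} (hw : w ∈ Submodule.span K (b '' (J : Set I))) (hf : ∀ j ∈ J, f j w = 0) :
    w = 0 := by
  obtain ⟨d, rfl⟩ := (Submodule.mem_span_image_finset_iff_exists_fun K).1 hw
  have hd : d = 0 := by
    refine Matrix.eq_zero_of_vecMul_eq_zero hdet ?_
    ext j
    have h := hf j.1 j.2
    rw [map_sum] at h
    simpa [Matrix.vecMul, dotProduct] using h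
  simp [hd]


/-- for `P := I(λ̌_G)` there exists `λ̌_P ∈ Λ̌_P` with
`φ_P(λ̌_P) = φ_I(λ̌_G)` and `π_P(λ̌_P) = λ̌_G`. -/
theorem parabolic_degree_exists
    -- `Λ̌`, a finitely generated free `ℤ`-module
    (Λ : Type*) [AddCommGroup Λ] [Module ℤ Λ] [Module.Free ℤ Λ] [Module.Finite ℤ Λ]
    -- `Λ̌_ℚ = Λ̌ ⊗ ℚ`, realized as a `ℚ`-vector space containing `Λ̌` via `ι` and spanned by it
    (V : Type*) [AddCommGroup V] [Module ℚ V]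
    (ι : Λ →ₗ[ℤ] V) (hι : Function.Injective ι)
    (hspan : Submodule.span ℚ (Set.range ι) = ⊤)
    -- the finite index set, the simple coroots and the simple roots
    (I : Type*) [Fintype I] [DecidableEq I]
    (a : I → Λ)
    (ha : LinearIndependent ℚ (fun i => ι (a i)))
    (α : I → (Λ →ₗ[ℤ] ℤ))
    -- the `ℚ`-linear extensions of the simple roots to `Λ̌_ℚ`
    (αQ : I → (V →ₗ[ℚ] ℚ))
    (hαQ : ∀ i x, αQ i (ι x) = (α i x : ℚ))
    -- all submatrices `(α_j(ǎ_i))_{i,j ∈ J}` of the Cartan matrix are invertible over `ℚ`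
    (hinv : ∀ J : Finset I,
      (Matrix.of fun i j : {x // x ∈ J} => ((α j.1 (a i.1) : ℤ) : ℚ)).det ≠ 0)
    -- the slope maps `φ_J : Λ̌_J → Λ̌_ℚ`, with their defining property
    (φ : ∀ J : Finset I, (Λ ⧸ Submodule.span ℤ (a '' (J : Set I))) → V)
    (hφ : ∀ (J : Finset I) (lam : Λ),
      (∀ j ∈ J, αQ j (φ J (Submodule.Quotient.mk lam)) = 0) ∧
      φ J (Submodule.Quotient.mk lam) - ι lam ∈
        Submodule.span ℚ ((fun i => ι (a i)) '' (J : Set I)))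
    -- the natural projections `π_J : Λ̌_J → Λ̌_I`
    (π : ∀ J : Finset I, (Λ ⧸ Submodule.span ℤ (a '' (J : Set I))) →
      (Λ ⧸ Submodule.span ℤ (a '' ((Finset.univ : Finset I) : Set I))))
    (hπ : ∀ (J : Finset I) (lam : Λ),
      π J (Submodule.Quotient.mk lam) = Submodule.Quotient.mk lam)
    -- a fixed degree `λ̌_G ∈ Λ̌_I`, a lift `lam0` of it, and the coefficients
    -- `c i` of `φ_I(λ̌_G) - λ̌` in the basis of simple coroots
    (lamG : Λ ⧸ Submodule.span ℤ (a '' ((Finset.univ : Finset I) : Set I)))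
    (lam0 : Λ) (hlam0 : Submodule.Quotient.mk lam0 = lamG)
    (c : I → ℚ)
    (hc : φ Finset.univ lamG - ι lam0 = ∑ i, c i • ι (a i))
    -- `P := I(λ̌_G) = {i ∈ I : c_i ∉ ℤ}`
    (P : Finset I) (hP : ∀ i, i ∈ P ↔ ¬∃ n : ℤ, (n : ℚ) = c i) :
    ∃ lamP : Λ ⧸ Submodule.span ℤ (a '' (P : Set I)),
      φ P lamP = φ Finset.univ lamG ∧ π P lamP = lamG := by
  have hint : ∀ i, ∃ m : ℤ, if i ∈ P then m = 0 else (m : ℚ) = c i := by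
    intro i
    by_cases hi : i ∈ P
    · exact ⟨0, by simp [hi]⟩
    · obtain ⟨m, hm⟩ := not_not.1 (mt (hP i).2 hi)
      exact ⟨m, by simpa [hi] using hm⟩
  choose n hn using hint
  set lam : Λ := lam0 + ∑ i, n i • a i with hlam
  have hlamG : (Submodule.Quotient.mk lam :
      Λ ⧸ Submodule.span ℤ (a '' ((Finset.univ : Finset I) : Set I))) = lamG := by
    rw [← hlam0, Submodule.Quotient.eq, hlam, add_sub_cancel_left]
    exact Submodule.sum_mem _ fun i _ =>
      zsmul_mem (Submodule.subset_span (Set.mem_image_of_mem a (by simp))) (n i)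
  refine ⟨Submodule.Quotient.mk lam, ?_, by rw [hπ, hlamG]⟩
  have hdiff : φ Finset.univ lamG - ι lam ∈
      Submodule.span ℚ ((fun i => ι (a i)) '' (P : Set I)) := by
    have h : φ Finset.univ lamG - ι lam = ∑ i, (c i - n i) • ι (a i) := by
      simp only [hlam, map_add, map_sum, map_zsmul, sub_smul, Finset.sum_sub_distrib,
        ← hc, Int.cast_smul_eq_zsmul]
      abel
    rw [h]
    refine Submodule.sum_mem _ fun i _ => ?_
    by_cases hi : i ∈ P
    · exact Submodule.smul_mem _ _ (Submodule.subset_span ⟨i, hi, rfl⟩)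
    · have hni := hn i
      rw [if_neg hi] at hni
      simp [hni]
  obtain ⟨hP0, hPspan⟩ := hφ P lam
  refine sub_eq_zero.1 (eq_zero_of_mem_span_of_det_ne_zero P (fun i => ι (a i)) αQ ?_ ?_ ?_)
  · simpa only [hαQ] using hinv P
  · simpa using Submodule.sub_mem _ hPspan hdiff
  · intro j hj
    have hG := (hφ Finset.univ lam0).1 j (Finset.mem_univ j)
    rw [hlam0] at hG
    rw [map_sub, hP0 j hj, hG, sub_zero]
end

section
/- Let w ∈ W and suppose there is a permutation τ of J := I(λ̌_G) such that w(ǎ_j) = ǎ_{τ(j)} and α_{τ(j)} ∘ w = α_j for all j ∈ J. Then w preserves span_ℤ{ǎ_j : j ∈ J}, hence induces an automorphism w̄ of Λ̌_J, and w̄(λ̌_J) = λ̌_J, where λ̌_J ∈ Λ̌_J is the unique element with φ_J(λ̌_J) = φ_I(λ̌_G) and π_J(λ̌_J) = λ̌_G. (This is the invariance W_{M,G}(λ̌_P) = λ̌_P of the distinguished degree under the relative Weyl group, proved in the paper's main theorem.) -/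
section

variable {Λ : Type*} [AddCommGroup Λ] [Module ℤ Λ] {I : Type*}

/-- Products of simple reflections fix every vector killed by all simple roots. -/
theorem weyl_apply_eq_self {a : I → Λ} {α : I → (Λ →ₗ[ℤ] ℤ)} {w : Λ ≃ₗ[ℤ] Λ}
    (hw : w ∈ Subgroup.closure {s : Λ ≃ₗ[ℤ] Λ | ∃ i : I, ∀ x : Λ, s x = x - α i x • a i})
    {y : Λ} (hy : ∀ i, α i y = 0) : w y = y := by
  induction hw using Subgroup.closure_induction with
  | mem s hs =>
    obtain ⟨i, hi⟩ := hs
    rw [hi, hy, zero_smul, sub_zero]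
  | one => rfl
  | mul s t _ _ hs ht => rw [LinearEquiv.mul_apply, ht, hs]
  | inv s _ hs => exact (LinearEquiv.symm_apply_eq s).2 hs.symm

/-- Products of simple reflections act trivially modulo the coroot lattice. -/
theorem weyl_apply_sub_mem_span {a : I → Λ} {α : I → (Λ →ₗ[ℤ] ℤ)} {w : Λ ≃ₗ[ℤ] Λ}
    (hw : w ∈ Subgroup.closure {s : Λ ≃ₗ[ℤ] Λ | ∃ i : I, ∀ x : Λ, s x = x - α i x • a i})
    (x : Λ) : w x - x ∈ Submodule.span ℤ (Set.range a) := by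
  induction hw using Subgroup.closure_induction generalizing x with
  | mem s hs =>
    obtain ⟨i, hi⟩ := hs
    rw [hi, sub_sub_cancel_left]
    exact neg_mem (zsmul_mem (Submodule.subset_span (Set.mem_range_self i)) _)
  | one => simp
  | mul s t _ _ hs ht =>
    rw [LinearEquiv.mul_apply, ← sub_add_sub_cancel _ (t x)]
    exact add_mem (hs _) (ht _)
  | inv s _ hs =>
    have h := neg_mem (hs (s⁻¹ x))
    rwa [neg_sub, ← LinearEquiv.mul_apply, mul_inv_cancel] at h

/-- The span of part of a linearly independent family is saturated in the span of the family. -/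
theorem LinearIndependent.mem_span_image_of_smul_mem {a : I → Λ} (ha : LinearIndependent ℤ a)
    {s : Set I} {z : Λ} (hz : z ∈ Submodule.span ℤ (Set.range a)) {n : ℤ} (hn : n ≠ 0)
    (h : n • z ∈ Submodule.span ℤ (a '' s)) : z ∈ Submodule.span ℤ (a '' s) := by
  obtain ⟨l, rfl⟩ := (Finsupp.mem_span_range_iff_exists_finsupp).1 hz
  obtain ⟨m, hm, hml⟩ := (Finsupp.mem_span_image_iff_linearCombination ℤ).1 h
  refine (Finsupp.mem_span_image_iff_linearCombination ℤ).2 ⟨l, ?_, rfl⟩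
  have hmn : m = n • l := ha (by
    rw [hml, map_zsmul]
    rfl)
  rw [Finsupp.mem_supported'] at hm ⊢
  intro i hi
  have := hm i hi
  rw [hmn, Finsupp.smul_apply, smul_eq_mul] at this
  exact (mul_eq_zero.1 this).resolve_left hn

/-- A vector in a rational span has a nonzero integral multiple in the integral span. -/
theorem exists_smul_eq_of_mem_span_rat {V : Type*} [AddCommGroup V] [Module ℚ V]
    (ι : Λ →ₗ[ℤ] V) {s : Set Λ} {u : V} (hu : u ∈ Submodule.span ℚ (ι '' s)) :
    ∃ n : ℤ, n ≠ 0 ∧ ∃ y ∈ Submodule.span ℤ s, n • u = ι y := by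
  induction hu using Submodule.span_induction with
  | mem u hu =>
    obtain ⟨x, hx, rfl⟩ := hu
    exact ⟨1, one_ne_zero, x, Submodule.subset_span hx, one_smul _ _⟩
  | zero => exact ⟨1, one_ne_zero, 0, zero_mem _, by simp⟩
  | add u v _ _ hu hv =>
    obtain ⟨n, hn, y, hy, hny⟩ := hu
    obtain ⟨m, hm, z, hz, hmz⟩ := hv
    refine ⟨n * m, mul_ne_zero hn hm, m • y + n • z,
      add_mem (zsmul_mem hy _) (zsmul_mem hz _), ?_⟩
    rw [map_add, map_zsmul, map_zsmul, ← hny, ← hmz, smul_smul, smul_smul, smul_add, mul_comm m n]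
  | smul q u _ hu =>
    obtain ⟨n, hn, y, hy, hny⟩ := hu
    refine ⟨n * q.den, mul_ne_zero hn (by exact_mod_cast q.den_nz), q.num • y,
      zsmul_mem hy _, ?_⟩
    rw [map_zsmul, ← hny, ← Int.cast_smul_eq_zsmul ℚ, ← Int.cast_smul_eq_zsmul ℚ,
      ← Int.cast_smul_eq_zsmul ℚ, smul_smul, smul_smul]
    congr 1
    push_cast
    rw [mul_assoc, Rat.den_mul_eq_num, mul_comm]

end


/-- an element `w` of the Weyl group permuting the coroots (and roots)
indexed by `J = I(λ̌_G)` preserves `span_ℤ{ǎ_j : j ∈ J}`, hence induces `w̄` on `Λ̌_J`,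
and `w̄` fixes the distinguished degree `λ̌_J`. -/
theorem weyl_fixes_distinguished_degree
    -- `Λ̌`, a finitely generated free `ℤ`-module
    (Λ : Type*) [AddCommGroup Λ] [Module ℤ Λ] [Module.Free ℤ Λ] [Module.Finite ℤ Λ]
    -- `Λ̌_ℚ = Λ̌ ⊗ ℚ`, realized as a `ℚ`-vector space containing `Λ̌` via `ι` and spanned by it
    (V : Type*) [AddCommGroup V] [Module ℚ V]
    (ι : Λ →ₗ[ℤ] V) (hι : Function.Injective ι)
    (hspan : Submodule.span ℚ (Set.range ι) = ⊤)
    -- the finite index set, the simple coroots and the simple roots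
    (I : Type*) [Fintype I] [DecidableEq I]
    (a : I → Λ)
    (ha : LinearIndependent ℚ (fun i => ι (a i)))
    (α : I → (Λ →ₗ[ℤ] ℤ))
    -- the `ℚ`-linear extensions of the simple roots to `Λ̌_ℚ`
    (αQ : I → (V →ₗ[ℚ] ℚ))
    (hαQ : ∀ i x, αQ i (ι x) = (α i x : ℚ))
    -- all submatrices `(α_j(ǎ_i))_{i,j ∈ J}` of the Cartan matrix are invertible over `ℚ`
    (hinv : ∀ J : Finset I,
      (Matrix.of fun i j : {x // x ∈ J} => ((α j.1 (a i.1) : ℤ) : ℚ)).det ≠ 0)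
    -- the slope maps `φ_J : Λ̌_J → Λ̌_ℚ`, with their defining property
    (φ : ∀ J : Finset I, (Λ ⧸ Submodule.span ℤ (a '' (J : Set I))) → V)
    (hφ : ∀ (J : Finset I) (lam : Λ),
      (∀ j ∈ J, αQ j (φ J (Submodule.Quotient.mk lam)) = 0) ∧
      φ J (Submodule.Quotient.mk lam) - ι lam ∈
        Submodule.span ℚ ((fun i => ι (a i)) '' (J : Set I)))
    -- the natural projections `π_J : Λ̌_J → Λ̌_I`
    (π : ∀ J : Finset I, (Λ ⧸ Submodule.span ℤ (a '' (J : Set I))) →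
      (Λ ⧸ Submodule.span ℤ (a '' ((Finset.univ : Finset I) : Set I))))
    (hπ : ∀ (J : Finset I) (lam : Λ),
      π J (Submodule.Quotient.mk lam) = Submodule.Quotient.mk lam)
    -- a fixed degree `λ̌_G ∈ Λ̌_I`, a lift `lam0` of it, and the coefficients
    -- `c i` of `φ_I(λ̌_G) - λ̌` in the basis of simple coroots
    (lamG : Λ ⧸ Submodule.span ℤ (a '' ((Finset.univ : Finset I) : Set I)))
    (lam0 : Λ) (hlam0 : Submodule.Quotient.mk lam0 = lamG)
    (c : I → ℚ)
    (hc : φ Finset.univ lamG - ι lam0 = ∑ i, c i • ι (a i))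
    -- `α_i(ǎ_i) = 2`
    (hdiag : ∀ i, α i (a i) = 2)
    -- `P := I(λ̌_G) = {i ∈ I : c_i ∉ ℤ}`
    (P : Finset I) (hP : ∀ i, i ∈ P ↔ ¬∃ n : ℤ, (n : ℚ) = c i)
    -- an element `w` of the Weyl group `W`, the subgroup of automorphisms of `Λ̌`
    -- generated by the simple reflections `s_i : x ↦ x − α_i(x)·ǎ_i`
    (w : Λ ≃ₗ[ℤ] Λ)
    (hw : w ∈ Subgroup.closure {s : Λ ≃ₗ[ℤ] Λ | ∃ i : I, ∀ x : Λ, s x = x - α i x • a i})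
    -- a permutation `τ` of `P` with `w(ǎ_j) = ǎ_{τ(j)}` and `α_{τ(j)} ∘ w = α_j` on `P`
    (τ : Equiv.Perm {x // x ∈ P})
    (hτa : ∀ j : {x // x ∈ P}, w (a j.1) = a (τ j).1)
    (hτα : ∀ (j : {x // x ∈ P}) (x : Λ), α (τ j).1 (w x) = α j.1 x) :
    -- `w` preserves `span_ℤ{ǎ_j : j ∈ P}`,
    (∀ x ∈ Submodule.span ℤ (a '' (P : Set I)), w x ∈ Submodule.span ℤ (a '' (P : Set I))) ∧
    -- and the induced automorphism `w̄` of `Λ̌_P` fixes the distinguished degree `λ̌_P`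
    (∀ wbar : (Λ ⧸ Submodule.span ℤ (a '' (P : Set I))) →
        (Λ ⧸ Submodule.span ℤ (a '' (P : Set I))),
      (∀ x : Λ, wbar (Submodule.Quotient.mk x) = Submodule.Quotient.mk (w x)) →
      ∀ lamP : Λ ⧸ Submodule.span ℤ (a '' (P : Set I)),
        φ P lamP = φ Finset.univ lamG → π P lamP = lamG → wbar lamP = lamP) := by
  have hpres : ∀ x ∈ Submodule.span ℤ (a '' (P : Set I)),
      w x ∈ Submodule.span ℤ (a '' (P : Set I)) := by
    intro x hx
    refine (Submodule.span_le (p := (Submodule.span ℤ (a '' (P : Set I))).comap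
      (w : Λ →ₗ[ℤ] Λ))).2 ?_ hx
    rintro _ ⟨j, hj, rfl⟩
    exact Submodule.subset_span ⟨_, (τ ⟨j, hj⟩).2, (hτa ⟨j, hj⟩).symm⟩
  refine ⟨hpres, fun wbar hwbar lamP hφP _ => ?_⟩
  obtain ⟨x, rfl⟩ := Submodule.Quotient.mk_surjective _ lamP
  rw [hwbar, Submodule.Quotient.eq]
  have haZ : LinearIndependent ℤ a :=
    (ha.restrict_scalars' ℤ).of_comp ι
  have hker : ∀ i, αQ i (φ P (Submodule.Quotient.mk x)) = 0 := fun i => by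
    rw [hφP, ← hlam0]
    exact (hφ Finset.univ lam0).1 i (Finset.mem_univ i)
  have hmem := (hφ P x).2
  rw [← Function.comp_def, Set.image_comp] at hmem
  obtain ⟨n, hn, y, hy, hny⟩ := exists_smul_eq_of_mem_span_rat ι hmem
  have hfix : w (y + n • x) = y + n • x := weyl_apply_eq_self hw fun i => by
    have h : ι (y + n • x) = n • φ P (Submodule.Quotient.mk x) := by
      rw [map_add, map_zsmul, ← hny, zsmul_sub, sub_add_cancel]
    have h' := hαQ i (y + n • x)
    rw [h, map_zsmul, hker, smul_zero] at h'
    exact_mod_cast h'.symm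
  refine haZ.mem_span_image_of_smul_mem (weyl_apply_sub_mem_span hw x) hn ?_
  have h : n • (w x - x) = y - w y := by
    rw [map_add, map_zsmul] at hfix
    rw [zsmul_sub, sub_eq_sub_iff_add_eq_add, add_comm, hfix]
  rw [h]
  exact sub_mem hy (hpres y hy)
end

section
/- Let b = (b_1, …, b_{k−1}) be a vector of integers and set q := C(k)^{-1} b ∈ ℚ^{k−1}. If e ≥ 2 is a common divisor of k and of all the entries b_1, …, b_{k−1}, then the entry q_{k/e} is an integer. (This is the integrality observation used in the paper's proof that stable G-bundles on an elliptic curve exist only for type A with coprimality conditions.) -/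
/-- The extension of `q : Fin m → ℚ` to one-based indices in `ℕ`, by zero outside `1, …, m`. -/
def zeroExtend {m : ℕ} (q : Fin m → ℚ) (n : ℕ) : ℚ :=
  ∑ j : Fin m, if (j : ℕ) + 1 = n then q j else 0

theorem zeroExtend_zero {m : ℕ} (q : Fin m → ℚ) : zeroExtend q 0 = 0 := by
  simp [zeroExtend]

theorem zeroExtend_of_lt {m n : ℕ} (q : Fin m → ℚ) (h : m < n) : zeroExtend q n = 0 :=
  Finset.sum_eq_zero fun j _ => if_neg (by have := j.isLt; omega)

theorem zeroExtend_val_add_one {m : ℕ} (q : Fin m → ℚ) (i : Fin m) :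
    zeroExtend q ((i : ℕ) + 1) = q i := by
  simp [zeroExtend, Fin.val_inj]

theorem mulVec_cartan_typeA {m : ℕ} {A : Matrix (Fin m) (Fin m) ℚ}
    (hA : ∀ i j, A i j =
      if i = j then 2 else if (i : ℕ) + 1 = (j : ℕ) ∨ (j : ℕ) + 1 = (i : ℕ) then -1 else 0)
    (q : Fin m → ℚ) (i : Fin m) :
    A.mulVec q i =
      2 * zeroExtend q ((i : ℕ) + 1) - zeroExtend q i - zeroExtend q ((i : ℕ) + 2) := by
  simp only [zeroExtend, Matrix.mulVec, dotProduct, Finset.mul_sum, ← Finset.sum_sub_distrib]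
  refine Finset.sum_congr rfl fun j _ => ?_
  rw [hA]
  simp only [Fin.ext_iff]
  split_ifs <;> first | omega | ring

/-- A sequence vanishing at `0` whose second differences are integer multiples of `e` is linear
up to integer multiples of `e`. -/
theorem exists_eq_mul_sub_of_second_difference {Q : ℕ → ℚ} {e k : ℕ} (h0 : Q 0 = 0)
    (h : ∀ j, j + 2 ≤ k → ∃ c : ℤ, 2 * Q (j + 1) - Q j - Q (j + 2) = e * c) :
    ∀ j ≤ k, ∃ m : ℤ, Q j = j * Q 1 - e * m := by
  intro j
  induction j using Nat.twoStepInduction with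
  | zero => exact fun _ => ⟨0, by simp [h0]⟩
  | one => exact fun _ => ⟨0, by simp⟩
  | more j ih₁ ih₂ =>
    intro hj
    obtain ⟨a, ha⟩ := ih₁ (by omega)
    obtain ⟨b, hb⟩ := ih₂ (by omega)
    obtain ⟨c, hc⟩ := h j hj
    refine ⟨2 * b - a + c, ?_⟩
    push_cast at hb ⊢
    linear_combination 2 * hb - ha - hc


/-- if `e ≥ 2` divides `k` and every entry of the integer vector `b`, then
the entry with (one-based) index `k/e` of `q := C(k)⁻¹ b` is an integer. -/
theorem inverse_cartan_typeA_integral_entry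
    (k : ℕ) (hk : 2 ≤ k)
    (A : Matrix (Fin (k - 1)) (Fin (k - 1)) ℚ)
    (hA : ∀ i j, A i j =
      if i = j then 2 else if (i : ℕ) + 1 = (j : ℕ) ∨ (j : ℕ) + 1 = (i : ℕ) then -1 else 0)
    (b : Fin (k - 1) → ℤ)
    (q : Fin (k - 1) → ℚ)
    (hq : q = A⁻¹.mulVec fun i => (b i : ℚ))
    (e : ℕ) (he : 2 ≤ e) (hek : e ∣ k) (heb : ∀ i, (e : ℤ) ∣ b i) :
    ∀ i : Fin (k - 1), (i : ℕ) + 1 = k / e → ∃ n : ℤ, q i = (n : ℚ) := by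
  intro i hi
  by_cases hdet : IsUnit A.det
  · have hAq : A.mulVec q = fun i => (b i : ℚ) := by
      rw [hq, Matrix.mulVec_mulVec, Matrix.mul_nonsing_inv A hdet, Matrix.one_mulVec]
    have hlin := exists_eq_mul_sub_of_second_difference (e := e) (k := k) (zeroExtend_zero q)
      fun j hj => by
        obtain ⟨c, hc⟩ := heb ⟨j, by omega⟩
        refine ⟨c, ?_⟩
        rw [← mulVec_cartan_typeA hA q ⟨j, by omega⟩, hAq]
        simp [hc]
    obtain ⟨d, rfl⟩ := hek
    rw [Nat.mul_div_cancel_left d (by omega)] at hi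
    obtain ⟨s, hs⟩ := hlin (e * d) le_rfl
    obtain ⟨t, ht⟩ := hlin d (Nat.le_mul_of_pos_left d (by omega))
    rw [zeroExtend_of_lt q (by omega)] at hs
    have hqi : q i = zeroExtend q d := by
      rw [← zeroExtend_val_add_one q i, congrArg (zeroExtend q) hi]
    have he0 : (e : ℚ) ≠ 0 := by positivity
    have hds : (d : ℚ) * zeroExtend q 1 = s := by
      apply mul_left_cancel₀ he0
      push_cast at hs
      linear_combination -hs
    exact ⟨s - e * t, by rw [hqi, ht, hds]; push_cast; rfl⟩
  · exact ⟨0, by simp [hq, Matrix.nonsing_inv_apply_not_isUnit A hdet]⟩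
end

section
/- The matrix C(n) is invertible over ℚ, and for every even index i ∈ {1,…,n} all entries of the i-th row of C(n)^{-1} are integers. (This is part of the inspection of inverse Cartan matrices in the paper's proof that stable bundles force type A.) -/
/-- A three-term row of a tridiagonal matrix, applied to a sequence. -/
theorem sum_range_tridiagonal_row (n i : ℕ) (hi : i < n) (a b c : ℚ) (f : ℕ → ℚ) :
    ∑ k ∈ Finset.range n, (if i = k then a else if k + 1 = i then b
      else if i + 1 = k then c else 0) * f k =
      a * f i + (if i = 0 then 0 else b * f (i - 1)) +
        (if i + 1 < n then c * f (i + 1) else 0) := by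
  have split_row : ∀ k, (if i = k then a else if k + 1 = i then b
      else if i + 1 = k then c else 0) * f k =
      (if i = k then a * f k else 0) +
        (if i - 1 = k then (if i = 0 then 0 else b * f k) else 0) +
        (if i + 1 = k then c * f k else 0) := by
    intro k
    split_ifs <;> first | omega | simp
  simp_rw [split_row, Finset.sum_add_distrib, Finset.sum_ite_eq, Finset.mem_range]
  rw [if_pos hi, if_pos (by omega : i - 1 < n)]

/-- The inverse of the Cartan matrix of type `C_n`, with zero-based indices. -/
def inverseCartanTypeC (n : ℕ) : Matrix (Fin n) (Fin n) ℚ := fun i j =>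
  if (j : ℕ) + 1 = n then ((i : ℕ) + 1 : ℚ) / 2
  else ((min ((i : ℕ) + 1) ((j : ℕ) + 1) : ℕ) : ℚ)


/-- the Cartan matrix of type `C_n` is invertible over `ℚ` and every row of
its inverse with even one-based index has integer entries. -/
theorem inverse_cartan_typeC
    (n : ℕ) (hn : 2 ≤ n)
    (C : Matrix (Fin n) (Fin n) ℚ)
    (hC : ∀ i j : Fin n, C i j =
      if i = j then 2
      else if (j : ℕ) + 1 = (i : ℕ) ∧ (i : ℕ) = n - 1 then -2
      else if (i : ℕ) + 1 = (j : ℕ) ∨ (j : ℕ) + 1 = (i : ℕ) then -1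
      else 0) :
    IsUnit C ∧ ∀ i : Fin n, 2 ∣ (i : ℕ) + 1 → ∀ j : Fin n, ∃ m : ℤ, C⁻¹ i j = (m : ℚ) := by
  have mul_inverse : C * inverseCartanTypeC n = 1 := by
    ext ⟨i, hi⟩ ⟨j, hj⟩
    let f : ℕ → ℚ := fun k =>
      if j + 1 = n then ((k : ℚ) + 1) / 2 else ((min (k + 1) (j + 1) : ℕ) : ℚ)
    have row : ∀ k : Fin n, C ⟨i, hi⟩ k * inverseCartanTypeC n k ⟨j, hj⟩ =
        (if i = k then 2 else if (k : ℕ) + 1 = i then (if i + 1 = n then -2 else -1)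
          else if i + 1 = k then -1 else 0) * f k := by
      intro k
      congr 1
      rw [hC]
      simp only [Fin.ext_iff]
      split_ifs <;> first | rfl | omega
    rw [Matrix.mul_apply, Finset.sum_congr rfl fun k _ => row k,
      Fin.sum_univ_eq_sum_range (fun k => (if i = k then 2 else if k + 1 = i then
        (if i + 1 = n then -2 else -1) else if i + 1 = k then -1 else 0) * f k) n,
      sum_range_tridiagonal_row n i hi, Matrix.one_apply]
    simp only [Fin.mk.injEq, f]
    by_cases hjn : j + 1 = n
    · rcases i with _ | i <;> simp only [hjn, if_true] <;> split_ifs <;>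
        first | contradiction | omega | (push_cast [Nat.add_sub_cancel]; ring)
    · simp only [hjn, if_false]
      rcases lt_trichotomy i j with hij | hij | hij
      · rw [min_eq_left (by omega : i + 1 ≤ j + 1),
          min_eq_left (by omega : i - 1 + 1 ≤ j + 1),
          min_eq_left (by omega : i + 1 + 1 ≤ j + 1)]
        rcases i with _ | i <;> split_ifs <;>
          first | contradiction | omega | (push_cast [Nat.add_sub_cancel]; ring)
      · subst hij
        rw [min_eq_left (by omega : i + 1 ≤ i + 1),
          min_eq_left (by omega : i - 1 + 1 ≤ i + 1),
          min_eq_right (by omega : i + 1 ≤ i + 1 + 1)]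
        rcases i with _ | i <;> split_ifs <;>
          first | contradiction | omega | (push_cast [Nat.add_sub_cancel]; ring)
      · rw [min_eq_right (by omega : j + 1 ≤ i + 1),
          min_eq_right (by omega : j + 1 ≤ i - 1 + 1),
          min_eq_right (by omega : j + 1 ≤ i + 1 + 1)]
        split_ifs <;> first | omega | ring
  refine ⟨IsUnit.of_mul_eq_one _ mul_inverse, fun i hi j => ?_⟩
  rw [Matrix.inv_eq_right_inv mul_inverse, inverseCartanTypeC]
  split_ifs
  · obtain ⟨m, hm⟩ := hi
    refine ⟨m, ?_⟩
    have hm' : ((i : ℕ) : ℚ) + 1 = 2 * m := by exact_mod_cast hm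
    rw [hm']
    push_cast
    ring
  · exact ⟨(min ((i : ℕ) + 1) ((j : ℕ) + 1) : ℕ), by push_cast; rfl⟩
end

section
/- If C is not of type A — that is, C cannot be obtained from the tridiagonal matrix with all diagonal entries 2 and all entries immediately above and below the diagonal equal to −1 by one simultaneous permutation of its rows and columns — then C is invertible over ℚ and there exists an index i such that every entry of the i-th column of C^{-1} is an integer. Consequently, if there exists an integer vector b such that no entry of (Cᵀ)^{-1} b is an integer, then C is of type A. (This is the combinatorial core of the paper's Proposition that stable G-bundles on an elliptic curve exist only when the adjoint group is a product of projective linear groups.) -/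
open Matrix

/-- The data of a Cartan matrix of finite type, with symmetrizer `d`, on a connected graph. -/
structure IsFiniteCartan {n : ℕ} (C : Matrix (Fin n) (Fin n) ℤ) (d : Fin n → ℚ) : Prop where
  diag : ∀ i, C i i = 2
  off : ∀ i j, i ≠ j → C i j ≤ 0
  zero_iff : ∀ i j, i ≠ j → (C i j = 0 ↔ C j i = 0)
  conn : ∀ i j : Fin n, Relation.ReflTransGen (fun i j => i ≠ j ∧ C i j ≠ 0) i j
  d_pos : ∀ i, 0 < d i
  symm : ∀ i j, d i * (C i j : ℚ) = d j * (C j i : ℚ)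
  form_pos : ∀ x : Fin n → ℚ, x ≠ 0 → 0 < ∑ i, ∑ j, x i * (d i * (C i j : ℚ)) * x j

/-- Up to a simultaneous permutation of rows and columns, `C` is the Cartan matrix of type `A`. -/
def IsTypeA {n : ℕ} (C : Matrix (Fin n) (Fin n) ℤ) : Prop :=
  ∃ σ : Equiv.Perm (Fin n), ∀ i j : Fin n, C (σ i) (σ j) =
    if i = j then 2
    else if (i : ℕ) + 1 = (j : ℕ) ∨ (j : ℕ) + 1 = (i : ℕ) then -1
    else 0

/-- The bilinear form with matrix `D·C`. -/
noncomputable def cartanForm {n : ℕ} (C : Matrix (Fin n) (Fin n) ℤ) (d : Fin n → ℚ) :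
    LinearMap.BilinForm ℚ (Fin n → ℚ) :=
  Matrix.toBilin' (Matrix.of fun i j => d i * (C i j : ℚ))

/-- An integer vector viewed over `ℚ`. -/
def ratVec {n : ℕ} (v : Fin n → ℤ) : Fin n → ℚ := fun j => (v j : ℚ)

lemma cartanForm_apply {n : ℕ} (C : Matrix (Fin n) (Fin n) ℤ) (d x y : Fin n → ℚ) :
    cartanForm C d x y = ∑ i, ∑ j, x i * (d i * (C i j : ℚ)) * y j := by
  simp [cartanForm, Matrix.toBilin'_apply]

lemma cartanForm_ratVec {n : ℕ} (C : Matrix (Fin n) (Fin n) ℤ) (d x : Fin n → ℚ)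
    (v : Fin n → ℤ) :
    cartanForm C d x (ratVec v) = ∑ i, x i * (d i * ((C *ᵥ v) i : ℚ)) := by
  rw [cartanForm_apply]
  refine Finset.sum_congr rfl fun i _ => ?_
  simp only [ratVec, Matrix.mulVec, dotProduct, Int.cast_sum, Int.cast_mul, Finset.mul_sum]
  exact Finset.sum_congr rfl fun j _ => by ring

lemma cartanForm_single_ratVec {n : ℕ} (C : Matrix (Fin n) (Fin n) ℤ) (d : Fin n → ℚ)
    (v : Fin n → ℤ) (i : Fin n) :
    cartanForm C d (Pi.single i 1) (ratVec v) = d i * ((C *ᵥ v) i : ℚ) := by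
  rw [cartanForm_ratVec, Finset.sum_eq_single i] <;> simp +contextual

/-- The coordinates of `C *ᵥ v` split into the diagonal and the off-diagonal contribution. -/
lemma mulVec_eq_diag_add {n : ℕ} (C : Matrix (Fin n) (Fin n) ℤ) (v : Fin n → ℤ) (i : Fin n) :
    (C *ᵥ v) i = C i i * v i + ∑ j ∈ Finset.univ.erase i, C i j * v j := by
  simp [Matrix.mulVec, dotProduct]

/-- Nonnegative integers with sum `1` are all `0` except for a single `1`. -/
lemma exists_eq_one_of_sum_eq_one {ι : Type*} [DecidableEq ι] {s : Finset ι} {b : ι → ℤ}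
    (hb : ∀ j ∈ s, 0 ≤ b j) (hs : ∑ j ∈ s, b j = 1) :
    ∃ z ∈ s, b z = 1 ∧ ∀ j ∈ s, j ≠ z → b j = 0 := by
  obtain ⟨z, hz, hz0⟩ := Finset.exists_ne_zero_of_sum_ne_zero (hs.trans_ne one_ne_zero)
  have h1 := Finset.add_sum_erase s b hz
  have hn : ∀ j ∈ s.erase z, 0 ≤ b j := fun j hj => hb j (Finset.mem_of_mem_erase hj)
  have h2 := Finset.sum_nonneg hn
  have h3 := hb z hz
  have h4 : ∑ j ∈ s.erase z, b j = 0 := by lia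
  refine ⟨z, hz, by lia, fun j hj hjz => ?_⟩
  exact (Finset.sum_eq_zero_iff_of_nonneg hn).1 h4 j (Finset.mem_erase.2 ⟨hjz, hj⟩)

namespace IsFiniteCartan

variable {n : ℕ} {C : Matrix (Fin n) (Fin n) ℤ} {d : Fin n → ℚ}

lemma cartanForm_comm (h : IsFiniteCartan C d) (x y : Fin n → ℚ) :
    cartanForm C d x y = cartanForm C d y x := by
  rw [cartanForm_apply, cartanForm_apply, Finset.sum_comm]
  refine Finset.sum_congr rfl fun i _ => Finset.sum_congr rfl fun j _ => ?_
  rw [h.symm j i]; ring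

lemma cartanForm_self_pos (h : IsFiniteCartan C d) {x : Fin n → ℚ} (hx : x ≠ 0) :
    0 < cartanForm C d x x := by
  rw [cartanForm_apply]; exact h.form_pos x hx

lemma cartanForm_self_nonneg (h : IsFiniteCartan C d) (x : Fin n → ℚ) :
    0 ≤ cartanForm C d x x := by
  rcases eq_or_ne x 0 with rfl | hx
  · simp
  · exact (h.cartanForm_self_pos hx).le

lemma cartanForm_sub_self (h : IsFiniteCartan C d) (x y : Fin n → ℚ) :
    cartanForm C d (x - y) (x - y) =
      cartanForm C d x x - 2 * cartanForm C d y x + cartanForm C d y y := by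
  simp only [map_sub, LinearMap.sub_apply]
  rw [h.cartanForm_comm x y]; ring

lemma cartanForm_single_single (h : IsFiniteCartan C d) (i : Fin n) :
    cartanForm C d (Pi.single i 1) (Pi.single i 1) = 2 * d i := by
  have : (Pi.single i 1 : Fin n → ℚ) = ratVec (Pi.single i 1) := by
    ext j; by_cases hj : j = i <;> simp [ratVec, hj]
  nth_rw 2 [this]
  rw [cartanForm_single_ratVec]
  simp [h.diag]; ring

lemma isUnit_map (h : IsFiniteCartan C d) : IsUnit (C.map (fun z : ℤ => (z : ℚ))) := by
  rw [← Matrix.mulVec_injective_iff_isUnit]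
  refine (injective_iff_map_eq_zero (Matrix.mulVecLin (C.map (fun z : ℤ => (z : ℚ))))).2
    fun x hx => ?_
  by_contra hx0
  have hpos := h.form_pos x hx0
  have hrow : ∀ i, ∑ j, (C i j : ℚ) * x j = 0 := fun i => congrFun hx i
  have : ∑ i, ∑ j, x i * (d i * (C i j : ℚ)) * x j = 0 := by
    refine Finset.sum_eq_zero fun i _ => ?_
    have : ∑ j, x i * (d i * (C i j : ℚ)) * x j = x i * d i * ∑ j, (C i j : ℚ) * x j := by
      rw [Finset.mul_sum]; exact Finset.sum_congr rfl fun j _ => by ring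
    rw [this, hrow, mul_zero]
  exact hpos.ne' this

/-- On vectors of bounded norm the sum of the coordinates is bounded above. -/
lemma exists_sum_le (h : IsFiniteCartan C d) (c : ℚ) :
    ∃ b : ℤ, ∀ v : Fin n → ℤ, cartanForm C d (ratVec v) (ratVec v) = c → ∑ i, v i ≤ b := by
  obtain ⟨u, hu⟩ := (Matrix.mulVec_surjective_iff_isUnit.2 h.isUnit_map) fun i => (d i)⁻¹
  refine ⟨⌈(c + cartanForm C d u u) / 2⌉, fun v hv => ?_⟩
  have hsum : cartanForm C d (ratVec v) u = ((∑ i, v i : ℤ) : ℚ) := by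
    rw [cartanForm_apply, Int.cast_sum]
    refine Finset.sum_congr rfl fun i _ => ?_
    have hui : ∑ j, (C i j : ℚ) * u j = (d i)⁻¹ := congrFun hu i
    have : ∑ j, ratVec v i * (d i * (C i j : ℚ)) * u j
        = ratVec v i * d i * ∑ j, (C i j : ℚ) * u j := by
      rw [Finset.mul_sum]; exact Finset.sum_congr rfl fun j _ => by ring
    rw [this, hui, mul_assoc, mul_inv_cancel₀ (h.d_pos i).ne', mul_one, ratVec]
  have h1 := h.cartanForm_self_nonneg (ratVec v - u)
  rw [h.cartanForm_sub_self, hv, h.cartanForm_comm u, hsum] at h1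
  have h2 : ((∑ i, v i : ℤ) : ℚ) ≤ (c + cartanForm C d u u) / 2 := by linarith
  exact_mod_cast h2.trans (Int.le_ceil _)

/-- The orbit of a simple root under simple reflections contains a dominant vector. -/
lemma exists_dominant (h : IsFiniteCartan C d) (s : Fin n) :
    ∃ v : Fin n → ℤ, cartanForm C d (ratVec v) (ratVec v) = 2 * d s ∧ ∀ i, 0 ≤ (C *ᵥ v) i := by
  obtain ⟨b, hb⟩ := h.exists_sum_le (2 * d s)
  let P : ℤ → Prop := fun m =>
    ∃ v : Fin n → ℤ, cartanForm C d (ratVec v) (ratVec v) = 2 * d s ∧ ∑ i, v i = m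
  have hne : ∃ m, P m := by
    refine ⟨_, Pi.single s 1, ?_, rfl⟩
    have : ratVec (Pi.single s 1) = (Pi.single s 1 : Fin n → ℚ) := by
      ext j; by_cases hj : j = s <;> simp [ratVec, hj]
    rw [this, h.cartanForm_single_single]
  obtain ⟨m, ⟨v, hv, hvm⟩, hmax⟩ := Int.exists_greatest_of_bdd (P := P)
    ⟨b, fun m ⟨v, hv, hvm⟩ => hvm ▸ hb v hv⟩ hne
  refine ⟨v, hv, fun i => ?_⟩
  by_contra! hi
  have hrefl : ratVec (v - Pi.single i ((C *ᵥ v) i)) =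
      ratVec v - ((C *ᵥ v) i : ℚ) • (Pi.single i 1 : Fin n → ℚ) := by
    ext j; by_cases hj : j = i <;> simp [ratVec, hj]
  have := hmax _ ⟨v - Pi.single i ((C *ᵥ v) i), by
    rw [hrefl, h.cartanForm_sub_self]
    simp only [map_smul, LinearMap.smul_apply, smul_eq_mul]
    rw [cartanForm_single_ratVec, h.cartanForm_single_single, hv]
    ring, rfl⟩
  simp only [Pi.sub_apply, Finset.sum_sub_distrib, Finset.sum_pi_single', Finset.mem_univ,
    if_true] at this
  lia

/-- A dominant vector is nonnegative. -/
lemma nonneg_of_dominant (h : IsFiniteCartan C d) {v : Fin n → ℤ}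
    (hv : ∀ i, 0 ≤ (C *ᵥ v) i) (i : Fin n) : 0 ≤ v i := by
  by_contra! hi
  set w : Fin n → ℤ := fun j => max (-v j) 0 with hw
  have hw0 : ∀ j, 0 ≤ w j := fun j => le_max_right _ _
  have hne : ratVec w ≠ 0 := fun h0 => by
    have := congrFun h0 i
    simp only [ratVec, hw, Pi.zero_apply, Int.cast_eq_zero] at this
    lia
  have h1 : 0 ≤ cartanForm C d (ratVec w) (ratVec v) := by
    rw [cartanForm_ratVec]
    refine Finset.sum_nonneg fun j _ => ?_
    have := h.d_pos j
    have h2 : (0 : ℚ) ≤ ((C *ᵥ v) j : ℚ) := by exact_mod_cast hv j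
    have h3 : (0 : ℚ) ≤ ratVec w j := Int.cast_nonneg (hw0 j)
    positivity
  have h2 : cartanForm C d (ratVec w) (ratVec v) + cartanForm C d (ratVec w) (ratVec w) ≤ 0 := by
    rw [cartanForm_apply, cartanForm_apply, ← Finset.sum_add_distrib]
    refine Finset.sum_nonpos fun j _ => ?_
    rw [← Finset.sum_add_distrib]
    refine Finset.sum_nonpos fun k _ => ?_
    have key : w j * C j k * (v k + w k) ≤ 0 := by
      have hk : 0 ≤ v k + w k := by simp only [hw]; lia
      rcases eq_or_ne j k with rfl | hjk
      · have : w j * (v j + w j) = 0 := by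
          rcases le_total (v j) 0 with h0 | h0
          · have : v j + w j = 0 := by simp only [hw]; lia
            simp [this]
          · have : w j = 0 := by simp only [hw]; lia
            simp [this]
        rw [h.diag]; lia
      · exact mul_nonpos_of_nonpos_of_nonneg
          (mul_nonpos_of_nonneg_of_nonpos (hw0 j) (h.off j k hjk)) hk
    have key' : (w j : ℚ) * C j k * (v k + w k) ≤ 0 := by exact_mod_cast key
    have := mul_nonpos_of_nonneg_of_nonpos (h.d_pos j).le key'
    simp only [ratVec]
    linarith
  linarith [h.cartanForm_self_pos hne]

/-- A nonempty set of vertices closed under adjacency is everything. -/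
lemma forall_of_closed (h : IsFiniteCartan C d) {p : Fin n → Prop} {a : Fin n} (ha : p a)
    (hstep : ∀ i j, p i → i ≠ j → C i j ≠ 0 → p j) (b : Fin n) : p b := by
  induction h.conn a b with
  | refl => exact ha
  | tail _ hbc ih => exact hstep _ _ ih hbc.1 hbc.2

/-- A nonzero dominant vector has full support. -/
lemma pos_of_dominant (h : IsFiniteCartan C d) {v : Fin n → ℤ}
    (hv : ∀ i, 0 ≤ (C *ᵥ v) i) (hv0 : v ≠ 0) (i : Fin n) : 0 < v i := by
  have hnn := h.nonneg_of_dominant hv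
  refine (hnn i).lt_of_ne' fun hi => hv0 (funext fun b => ?_)
  refine h.forall_of_closed (p := fun k => v k = 0) hi (fun j k hj hjk hC => ?_) b
  have h1 := hv j
  rw [mulVec_eq_diag_add, hj, mul_zero, zero_add] at h1
  have hle : ∀ l ∈ Finset.univ.erase j, C j l * v l ≤ 0 := fun l hl =>
    mul_nonpos_of_nonpos_of_nonneg (h.off j l (Finset.ne_of_mem_erase hl).symm) (hnn l)
  have := (Finset.sum_eq_zero_iff_of_nonpos hle).1 (le_antisymm (Finset.sum_nonpos hle) h1) k
    (by simp [hjk.symm])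
  exact (mul_eq_zero.1 this).resolve_left hC

/-- Either some standard basis vector is in the lattice spanned by the columns of `C`, or there is
a positive vector sent to the sum of two basis vectors (or `n = 1`). -/
lemma exists_mulVec_eq (h : IsFiniteCartan C d) (hn : 1 < n) :
    ∃ v : Fin n → ℤ, (∀ i, 0 < v i) ∧ ((∃ i, C *ᵥ v = Pi.single i 1) ∨
      ∃ p q, p ≠ q ∧ v p = 1 ∧ C *ᵥ v = Pi.single p 1 + Pi.single q 1) := by
  have : Nonempty (Fin n) := ⟨⟨0, by lia⟩⟩
  obtain ⟨s, hs⟩ := Finite.exists_min d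
  obtain ⟨v, hv, hdom⟩ := h.exists_dominant s
  have hds := h.d_pos s
  have hv0 : v ≠ 0 := by
    rintro rfl
    have : ratVec (0 : Fin n → ℤ) = 0 := by ext; simp [ratVec]
    rw [this] at hv
    simp at hv
    linarith
  have hpos := h.pos_of_dominant hdom hv0
  have hle : ∀ i, (C *ᵥ v) i ≤ 1 := fun i => by
    have hne : ratVec v - Pi.single i 1 ≠ 0 := fun h0 => by
      obtain ⟨j, hj⟩ : ∃ j, j ≠ i := by
        have : Nontrivial (Fin n) := Fin.nontrivial_iff_two_le.2 hn
        exact exists_ne i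
      have := congrFun h0 j
      have hj' := hpos j
      simp [ratVec, hj] at this
      lia
    have h1 := h.cartanForm_self_pos hne
    rw [h.cartanForm_sub_self, hv, cartanForm_single_ratVec, h.cartanForm_single_single] at h1
    have h2 : d i * ((C *ᵥ v) i : ℚ) < d i * 2 := by linarith [hs i]
    have h3 := lt_of_mul_lt_mul_left h2 (h.d_pos i).le
    have : (C *ᵥ v) i < 2 := by exact_mod_cast h3
    lia
  have h01 : ∀ i, (C *ᵥ v) i = 0 ∨ (C *ᵥ v) i = 1 := fun i => by
    have := hle i; have := hdom i; lia
  rw [cartanForm_ratVec] at hv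
  have hterm : ∀ i, 0 ≤ ratVec v i * (d i * ((C *ᵥ v) i : ℚ)) := fun i => by
    have h1 : (0 : ℚ) < ratVec v i := Int.cast_pos.2 (hpos i)
    have h2 : (0 : ℚ) ≤ ((C *ᵥ v) i : ℚ) := Int.cast_nonneg (hdom i)
    have := h.d_pos i
    positivity
  have hterm1 : ∀ i, (C *ᵥ v) i = 1 → d s * v i ≤ ratVec v i * (d i * ((C *ᵥ v) i : ℚ)) := by
    intro i hi
    have h1 : (0 : ℚ) < (v i : ℚ) := Int.cast_pos.2 (hpos i)
    rw [hi, ratVec, Int.cast_one, mul_one, mul_comm]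
    exact mul_le_mul_of_nonneg_left (hs i) h1.le
  have hsub : ∀ t : Finset (Fin n), (∀ i ∈ t, (C *ᵥ v) i = 1) → ∑ i ∈ t, v i ≤ 2 := by
    intro t ht
    have h1 : ∑ i ∈ t, d s * (v i : ℚ) ≤ 2 * d s :=
      (Finset.sum_le_sum fun i hi => hterm1 i (ht i hi)).trans
        ((Finset.sum_le_sum_of_subset_of_nonneg t.subset_univ fun i _ _ => hterm i).trans hv.le)
    rw [← Finset.mul_sum, mul_comm 2] at h1
    exact_mod_cast le_of_mul_le_mul_left h1 hds
  obtain ⟨p, hp⟩ : ∃ p, (C *ᵥ v) p = 1 := by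
    by_contra! hall
    have : ∀ i, (C *ᵥ v) i = 0 := fun i => (h01 i).resolve_right (hall i)
    simp [this] at hv
    linarith
  refine ⟨v, hpos, ?_⟩
  by_cases hq : ∃ q, p ≠ q ∧ (C *ᵥ v) q = 1
  · obtain ⟨q, hpq, hq⟩ := hq
    right
    refine ⟨p, q, hpq, ?_, funext fun i => ?_⟩
    · have := hsub {p, q} (by simp [hp, hq])
      rw [Finset.sum_pair hpq] at this
      have := hpos p; have := hpos q
      lia
    · rcases eq_or_ne i p with rfl | hip
      · simp [hp, hpq]
      rcases eq_or_ne i q with rfl | hiq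
      · simp [hq, hip]
      rcases h01 i with h0 | h1
      · simp [h0, hip, hiq]
      · have := hsub {i, p, q} (by simp [hp, hq, h1])
        rw [Finset.sum_insert (by simp [hip, hiq]), Finset.sum_pair hpq] at this
        have := hpos p; have := hpos q; have := hpos i
        lia
  · left
    push Not at hq
    refine ⟨p, funext fun i => ?_⟩
    rcases eq_or_ne i p with rfl | hip
    · simp [hp]
    · simp [hip, (h01 i).resolve_right (hq i hip.symm)]

end IsFiniteCartan

open scoped Classical in
/-- `f 0, …, f k` is an injective path in the Dynkin graph of `C` starting at `p`, along which `v`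
takes the value `1`, such that the rows of `C` at all but its last vertex are those of type `A`. -/
structure IsInitialPath {n : ℕ} (C : Matrix (Fin n) (Fin n) ℤ) (v : Fin n → ℤ) (p q : Fin n)
    (k : ℕ) (f : ℕ → Fin n) : Prop where
  start : f 0 = p
  inj : ∀ i ≤ k, ∀ j ≤ k, f i = f j → i = j
  one : ∀ i ≤ k, v (f i) = 1
  ne_end : ∀ i < k, f i ≠ q
  row : ∀ i < k, ∀ j, j ≠ f i →
    C (f i) j = if j = f (i + 1) ∨ ∃ l, l + 1 = i ∧ j = f l then -1 else 0

namespace IsInitialPath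

variable {n : ℕ} {C : Matrix (Fin n) (Fin n) ℤ} {v : Fin n → ℤ} {p q : Fin n} {k : ℕ}
  {f : ℕ → Fin n}

lemma lt (h : IsInitialPath C v p q k f) : k < n := by
  have hinj : Function.Injective fun i : Fin (k + 1) => f i := fun i j hij =>
    Fin.ext (h.inj _ (by lia) _ (by lia) hij)
  simpa using Fintype.card_le_of_injective _ hinj

open scoped Classical in
/-- A path whose last vertex is a leaf exhausts the Dynkin graph. -/
lemma surjective_of_row {d : Fin n → ℚ} (hC : IsFiniteCartan C d)
    (h : IsInitialPath C v p q k f)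
    (hlast : ∀ j, j ≠ f k → C (f k) j ≠ 0 → ∃ l, l + 1 = k ∧ j = f l) (b : Fin n) :
    ∃ i ≤ k, f i = b := by
  refine hC.forall_of_closed (p := fun b => ∃ i ≤ k, f i = b) ⟨0, by lia, rfl⟩ ?_ b
  rintro _ j ⟨i, hi, rfl⟩ hij hne
  rcases hi.lt_or_eq with hi | rfl
  · rw [h.row i hi j hij.symm, ite_ne_right_iff] at hne
    obtain ⟨rfl | ⟨l, rfl, rfl⟩, -⟩ := hne
    exacts [⟨i + 1, hi, rfl⟩, ⟨l, by lia, rfl⟩]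
  · obtain ⟨l, rfl, rfl⟩ := hlast j hij.symm hne
    exact ⟨l, by lia, rfl⟩

open scoped Classical in
lemma isTypeA {d : Fin n → ℚ} (hC : IsFiniteCartan C d) (h : IsInitialPath C v p q k f)
    (hlast : ∀ j, j ≠ f k → C (f k) j = if ∃ l, l + 1 = k ∧ j = f l then -1 else 0) :
    IsTypeA C := by
  have hsurj := h.surjective_of_row hC fun j hj hne => by
    rw [hlast j hj, ite_ne_right_iff] at hne
    exact hne.1
  have hn : n = k + 1 := by
    refine le_antisymm ?_ h.lt
    have : Function.Surjective fun i : Fin (k + 1) => f i := fun b => by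
      obtain ⟨i, hi, rfl⟩ := hsurj b
      exact ⟨⟨i, by lia⟩, rfl⟩
    simpa using Fintype.card_le_of_surjective _ this
  have hinj : Function.Injective fun i : Fin n => f i := fun i j hij =>
    Fin.ext (h.inj _ (by lia) _ (by lia) hij)
  refine ⟨Equiv.ofBijective _ (Finite.injective_iff_bijective.1 hinj), fun i j => ?_⟩
  simp only [Equiv.ofBijective_apply]
  rcases eq_or_ne i j with rfl | hij
  · simp [hC.diag]
  rw [if_neg hij]
  have hf : f j ≠ f i := fun h0 => hij (hinj h0).symm
  have hfj : ∀ l ≤ k, (f j = f l ↔ (j : ℕ) = l) := fun l hl =>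
    ⟨h.inj _ (by lia) _ hl, fun h0 => h0 ▸ rfl⟩
  have hprev : (∃ l, l + 1 = (i : ℕ) ∧ f j = f l) ↔ (j : ℕ) + 1 = i := by
    constructor
    · rintro ⟨l, hl, h0⟩
      rw [hfj l (by lia)] at h0
      lia
    · exact fun h0 => ⟨j, h0, rfl⟩
  rcases Nat.lt_or_ge i k with hi | hi
  · rw [h.row i hi _ hf]
    exact if_congr (by rw [hprev, hfj _ hi, eq_comm]) rfl rfl
  · have hik : (i : ℕ) = k := by lia
    have hnext : ¬ (i : ℕ) + 1 = j := by lia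
    rw [hik] at hf hprev hnext ⊢
    rw [hlast _ hf]
    exact if_congr (by rw [hprev, or_iff_right hnext]) rfl rfl

open scoped Classical in
/-- A path can be prolonged by a neighbour of its last vertex other than its predecessor. -/
lemma extend {d : Fin n → ℚ} (hC : IsFiniteCartan C d) (h : IsInitialPath C v p q k f)
    {z : Fin n} (hz : z ≠ f k) (hvz : v z = 1) (hq : f k ≠ q)
    (hpred : ∀ l, l + 1 = k → z ≠ f l)
    (hrow : ∀ j, j ≠ f k → C (f k) j = if j = z ∨ ∃ l, l + 1 = k ∧ j = f l then -1 else 0) :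
    IsInitialPath C v p q (k + 1) fun i => if i ≤ k then f i else z := by
  have hnew : ∀ i ≤ k, f i ≠ z := by
    rintro i hi rfl
    have hik : i < k := hi.lt_of_ne fun h0 => hz (h0 ▸ rfl)
    have h1 : C (f k) (f i) ≠ 0 := by simp [hrow _ hz]
    rw [Ne, hC.zero_iff _ _ hz.symm, h.row i hik _ hz.symm, ← Ne, ite_ne_right_iff] at h1
    obtain ⟨h0 | ⟨l, hl, h0⟩, -⟩ := h1
    · exact hpred i (h.inj _ le_rfl _ hik h0).symm rfl
    · have := h.inj _ le_rfl _ (by lia) h0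
      lia
  refine ⟨by simp [h.start], fun i hi j hj hij => ?_, fun i hi => ?_, fun i hi => ?_,
    fun i hi j hj => ?_⟩
  · by_cases hik : i ≤ k <;> by_cases hjk : j ≤ k <;> simp only [hik, hjk, if_true, if_false] at hij
    · exact h.inj i hik j hjk hij
    · exact absurd hij (hnew i hik)
    · exact absurd hij.symm (hnew j hjk)
    · lia
  · split_ifs with hik
    exacts [h.one i hik, hvz]
  · have hik : i ≤ k := by lia
    simp only [hik, if_true]
    rcases hik.lt_or_eq with hik | rfl
    exacts [h.ne_end i hik, hq]
  · have hik : i ≤ k := by lia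
    simp only [hik, if_true] at hj ⊢
    have hprev : (∃ l, l + 1 = i ∧ j = if l ≤ k then f l else z) ↔ ∃ l, l + 1 = i ∧ j = f l :=
      exists_congr fun l => and_congr_right fun hl => by rw [if_pos (by lia)]
    rw [hprev]
    rcases hik.lt_or_eq with hik | rfl
    · rw [h.row i hik j hj, if_pos (Nat.succ_le_of_lt hik)]
    · simpa using hrow j hj

/-- If `C` is not of type `A` then every initial path can be prolonged. -/
lemma exists_succ {d : Fin n → ℚ} (hC : IsFiniteCartan C d) (hA : ¬ IsTypeA C)
    (hv : ∀ i, 0 < v i) (hpq : p ≠ q) (hCv : C *ᵥ v = Pi.single p 1 + Pi.single q 1)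
    (h : IsInitialPath C v p q k f) : ∃ g, IsInitialPath C v p q (k + 1) g := by
  have hsum := mulVec_eq_diag_add C v (f k)
  rw [hCv, hC.diag, h.one k le_rfl] at hsum
  have hb : ∀ j ∈ Finset.univ.erase (f k), 0 ≤ -(C (f k) j * v j) := fun j hj =>
    neg_nonneg.2 (mul_nonpos_of_nonpos_of_nonneg
      (hC.off _ _ (Finset.ne_of_mem_erase hj).symm) (hv j).le)
  have hz1 : ∀ z, -(C (f k) z * v z) = 1 → v z = 1 ∧ C (f k) z = -1 := fun z hz => by
    have h1 : v z = 1 := Int.eq_one_of_dvd_one (hv z).le ⟨-C (f k) z, by linarith⟩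
    rw [h1] at hz
    exact ⟨h1, by lia⟩
  have hz0 : ∀ z, -(C (f k) z * v z) = 0 → C (f k) z = 0 := fun z hz =>
    (mul_eq_zero.1 (neg_eq_zero.1 hz)).resolve_right (hv z).ne'
  obtain _ | m := k
  · rw [h.start] at hsum hb hz1 hz0
    have hs : ∑ j ∈ Finset.univ.erase p, -(C p j * v j) = 1 := by
      simp [hpq] at hsum ⊢
      lia
    obtain ⟨z, hz, hbz, hrest⟩ := exists_eq_one_of_sum_eq_one hb hs
    obtain ⟨hvz, hCz⟩ := hz1 z hbz
    refine ⟨_, h.extend hC (z := z) (by simpa [h.start] using hz) hvz (h.start ▸ hpq) (by simp)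
      fun j hj => ?_⟩
    rw [h.start] at hj ⊢
    rcases eq_or_ne j z with rfl | hjz
    · simp [hCz]
    · simp [hjz, hz0 j (hrest j (by simp [hj]) hjz)]
  · have hxy : f m ≠ f (m + 1) := fun h0 => by
      have := h.inj _ (by lia) _ le_rfl h0
      lia
    have hxp : f (m + 1) ≠ p := fun h0 => by
      have := h.inj _ le_rfl _ (by lia) (h0.trans h.start.symm)
      lia
    have hmem : f m ∈ Finset.univ.erase (f (m + 1)) := by simp [hxy]
    have hCy : C (f (m + 1)) (f m) < 0 := by
      refine (hC.off _ _ hxy.symm).lt_of_ne ?_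
      rw [Ne, hC.zero_iff _ _ hxy.symm, h.row m (by lia) _ hxy.symm]
      simp
    rw [← Finset.add_sum_erase _ _ hmem, h.one m (by lia)] at hsum
    set t := (Finset.univ.erase (f (m + 1))).erase (f m) with ht
    have hbt : ∀ j ∈ t, 0 ≤ -(C (f (m + 1)) j * v j) := fun j hj =>
      hb j (Finset.mem_of_mem_erase hj)
    have hmt : ∀ j, j ≠ f (m + 1) → j ≠ f m → j ∈ t := fun j h1 h2 => by simp [ht, h1, h2]
    have hnn := Finset.sum_nonneg hbt
    have hpred : ∀ j, (∃ l, l + 1 = m + 1 ∧ j = f l) ↔ j = f m := fun j => by simp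
    have hleaf : ∑ j ∈ t, -(C (f (m + 1)) j * v j) = 0 →
        ∀ j, j ≠ f (m + 1) → j ≠ f m → C (f (m + 1)) j = 0 := fun hs j h1 h2 =>
      hz0 j ((Finset.sum_eq_zero_iff_of_nonneg hbt).1 hs j (hmt j h1 h2))
    have hneg : ∑ j ∈ t, -(C (f (m + 1)) j * v j) = -∑ j ∈ t, C (f (m + 1)) j * v j := by simp
    rcases eq_or_ne (f (m + 1)) q with hxq | hxq
    · simp only [Pi.add_apply, Pi.single_apply, hxq, if_true] at hsum
      rw [hxq] at hCy hneg hnn hleaf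
      refine absurd (h.isTypeA hC fun j hj => ?_) hA
      rw [hpred, hxq]
      rcases eq_or_ne j (f m) with rfl | hjm
      · rw [if_pos rfl]; lia
      · rw [if_neg hjm]
        exact hleaf (by lia) j (hxq ▸ hj) hjm
    · simp only [Pi.add_apply, Pi.single_apply, hxp, hxq, if_false] at hsum
      by_cases hs : ∑ j ∈ t, -(C (f (m + 1)) j * v j) = 0
      · obtain ⟨i, hi, hiq⟩ := h.surjective_of_row hC (fun j hj hne => by
          rw [hpred]
          by_contra hjm
          exact hne (hleaf hs j hj hjm)) q
        rcases hi.lt_or_eq with hi | rfl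
        exacts [absurd hiq (h.ne_end i hi), absurd hiq hxq]
      · obtain ⟨z, hz, hbz, hrest⟩ := exists_eq_one_of_sum_eq_one hbt (by lia)
        obtain ⟨hvz, hCz⟩ := hz1 z hbz
        have hzm : z ≠ f m := Finset.ne_of_mem_erase hz
        have hzx : z ≠ f (m + 1) := Finset.ne_of_mem_erase (Finset.mem_of_mem_erase hz)
        refine ⟨_, h.extend hC hzx hvz hxq (fun l hl => by simpa [Nat.succ_injective hl] using hzm)
          fun j hj => ?_⟩
        rw [hpred]
        rcases eq_or_ne j z with rfl | hjz
        · simp [hCz]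
        rcases eq_or_ne j (f m) with rfl | hjm
        · rw [if_pos (Or.inr rfl)]; lia
        · rw [if_neg (by simp [hjz, hjm])]
          exact hz0 j (hrest j (hmt j hj hjm) hjz)

end IsInitialPath

namespace IsFiniteCartan

variable {n : ℕ} {C : Matrix (Fin n) (Fin n) ℤ} {d : Fin n → ℚ}

/-- Outside type `A`, some standard basis vector is an integral combination of the columns. -/
lemma exists_mulVec_eq_single (h : IsFiniteCartan C d) (hn : 1 ≤ n) (hA : ¬ IsTypeA C) :
    ∃ (v : Fin n → ℤ) (i : Fin n), C *ᵥ v = Pi.single i 1 := by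
  rcases hn.eq_or_lt with rfl | hn
  · refine absurd ⟨Equiv.refl _, fun i j => ?_⟩ hA
    obtain rfl := Subsingleton.elim i j
    simp [h.diag]
  obtain ⟨v, hpos, ⟨i, hi⟩ | ⟨p, q, hpq, hvp, hCv⟩⟩ := h.exists_mulVec_eq hn
  · exact ⟨v, i, hi⟩
  have hpath : ∀ k, ∃ f, IsInitialPath C v p q k f := fun k => by
    induction k with
    | zero =>
      exact ⟨fun _ => p, rfl, by lia, fun _ _ => hvp, by simp, by simp⟩
    | succ k ih =>
      obtain ⟨f, hf⟩ := ih
      exact hf.exists_succ h hA hpos hpq hCv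
  obtain ⟨f, hf⟩ := hpath n
  exact absurd hf.lt (lt_irrefl n)

/-- Outside type `A`, the inverse of `C` has an integral column. -/
lemma exists_integral_column (h : IsFiniteCartan C d) (hn : 1 ≤ n) (hA : ¬ IsTypeA C) :
    ∃ i : Fin n, ∀ j : Fin n, ∃ m : ℤ, (C.map (fun z : ℤ => (z : ℚ)))⁻¹ j i = (m : ℚ) := by
  obtain ⟨v, i, hv⟩ := h.exists_mulVec_eq_single hn hA
  refine ⟨i, fun j => ⟨v j, ?_⟩⟩
  have hvQ : C.map (fun z : ℤ => (z : ℚ)) *ᵥ ratVec v = Pi.single i 1 := by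
    ext k
    have hk := congrArg (Int.cast : ℤ → ℚ) (congrFun hv k)
    simp only [Matrix.mulVec, dotProduct, Int.cast_sum, Int.cast_mul] at hk
    simp only [Matrix.mulVec, dotProduct, Matrix.map_apply, ratVec, hk]
    by_cases hki : k = i <;> simp [hki]
  have hu := (Matrix.isUnit_iff_isUnit_det _).1 h.isUnit_map
  have := congrArg (fun w => ((C.map (fun z : ℤ => (z : ℚ)))⁻¹ *ᵥ w) j) hvQ
  simp only [Matrix.mulVec_mulVec, Matrix.nonsing_inv_mul _ hu, Matrix.one_mulVec,
    Matrix.mulVec_single_one, Matrix.col_apply] at this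
  exact this.symm

end IsFiniteCartan

/-- an indecomposable Cartan matrix of finite type which is not of type `A`
is invertible over `ℚ` and its inverse has a column consisting of integers; consequently, if
some integer vector `b` makes no entry of `(Cᵀ)⁻¹b` an integer, then `C` is of type `A`. -/
theorem not_typeA_integral_column
    (n : ℕ) (hn : 1 ≤ n)
    (C : Matrix (Fin n) (Fin n) ℤ)
    -- generalized Cartan matrix axioms
    (hdiag : ∀ i, C i i = 2)
    (hoff : ∀ i j, i ≠ j → C i j ≤ 0)
    (hsym0 : ∀ i j, i ≠ j → (C i j = 0 ↔ C j i = 0))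
    -- indecomposability: the graph with an edge between `i ≠ j` whenever `C i j ≠ 0`
    -- is connected
    (hconn : ∀ i j : Fin n, Relation.ReflTransGen (fun i j => i ≠ j ∧ C i j ≠ 0) i j)
    -- finite type: a positive diagonal `D` makes `D·C` symmetric positive definite
    (d : Fin n → ℚ) (hd : ∀ i, 0 < d i)
    (hDCsymm : ∀ i j, d i * (C i j : ℚ) = d j * (C j i : ℚ))
    (hDCpos : ∀ x : Fin n → ℚ, x ≠ 0 →
      0 < ∑ i, ∑ j, x i * (d i * (C i j : ℚ)) * x j)
    -- `CQ` is `C` viewed over `ℚ`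
    (CQ : Matrix (Fin n) (Fin n) ℚ)
    (hCQ : ∀ i j, CQ i j = (C i j : ℚ)) :
    -- if `C` is not of type `A` then `CQ` is invertible and `CQ⁻¹` has an integral column
    ((¬∃ σ : Equiv.Perm (Fin n), ∀ i j : Fin n, C (σ i) (σ j) =
        if i = j then 2
        else if (i : ℕ) + 1 = (j : ℕ) ∨ (j : ℕ) + 1 = (i : ℕ) then -1
        else 0) →
      IsUnit CQ ∧ ∃ i : Fin n, ∀ j : Fin n, ∃ m : ℤ, CQ⁻¹ j i = (m : ℚ)) ∧
    -- consequently, if some integer vector `b` makes no entry of `(Cᵀ)⁻¹b` integral,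
    -- then `C` is of type `A`
    ((∃ b : Fin n → ℤ, ∀ i : Fin n,
        ¬∃ m : ℤ, ((Matrix.transpose CQ)⁻¹.mulVec fun j => (b j : ℚ)) i = (m : ℚ)) →
      ∃ σ : Equiv.Perm (Fin n), ∀ i j : Fin n, C (σ i) (σ j) =
        if i = j then 2
        else if (i : ℕ) + 1 = (j : ℕ) ∨ (j : ℕ) + 1 = (i : ℕ) then -1
        else 0) := by
  have h : IsFiniteCartan C d := ⟨hdiag, hoff, hsym0, hconn, hd, hDCsymm, hDCpos⟩
  obtain rfl : CQ = C.map (fun z : ℤ => (z : ℚ)) := by ext i j; exact hCQ i j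
  refine ⟨fun hA => ⟨h.isUnit_map, h.exists_integral_column hn hA⟩, ?_⟩
  rintro ⟨b, hb⟩
  by_contra hA
  obtain ⟨i, hi⟩ := h.exists_integral_column hn hA
  choose m hm using hi
  refine hb i ⟨∑ j, m j * b j, ?_⟩
  simp [← Matrix.transpose_nonsing_inv, Matrix.mulVec, dotProduct, hm]
end
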